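/- Let p ≥ 1 and suppose u₀ ∈ C⁰(ℝⁿ) satisfies u₀(x) ≥ c₀·e^{−α|x|^β} for all x ∈ ℝⁿ, with positive constants c₀, α, β. Then there exist t₀ > 1 and C > 0 such that any positive classical solution u of the Cauchy problem (0) on ℝⁿ×(0,∞) satisfies ‖u(·,t)‖_{L^∞(ℝⁿ)} ≥ C · t^{−1/p} · (ln t)^{2/(pβ)} for all t ≥ t₀. -/

import Mathlib

open Real Set MeasureTheory Metric Filter

/-- The Laplacian of a function on `ℝⁿ`, written via iterated Fréchet derivatives
in the coordinate directions. -/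
noncomputable def lap {n : ℕ} (f : EuclideanSpace ℝ (Fin n) → ℝ)
    (x : EuclideanSpace ℝ (Fin n)) : ℝ :=
  ∑ i : Fin n, fderiv ℝ (fun y => fderiv ℝ f y (EuclideanSpace.single i 1)) x
    (EuclideanSpace.single i 1)

/-- `u` is a positive classical solution of the Cauchy problem `u_t = u^p Δu`,
`u(·,0) = u₀`, on `ℝⁿ × (0,T)`: it is continuous on `ℝⁿ × [0,T)`, attains the initial
data, is positive and spatially `C²` for `0 < t < T`, and satisfies the PDE pointwise. -/
def IsSolOn (n : ℕ) (p : ℝ) (u₀ : EuclideanSpace ℝ (Fin n) → ℝ)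
    (u : EuclideanSpace ℝ (Fin n) → ℝ → ℝ) (T : ℝ) : Prop :=
  ContinuousOn (fun z : (EuclideanSpace ℝ (Fin n)) × ℝ => u z.1 z.2) {z | 0 ≤ z.2 ∧ z.2 < T} ∧
  (∀ x, u x 0 = u₀ x) ∧
  (∀ x, ∀ t, 0 < t → t < T → 0 < u x t) ∧
  (∀ t, 0 < t → t < T → ContDiff ℝ 2 (fun y => u y t)) ∧
  (∀ x, ∀ t, 0 < t → t < T →
    HasDerivAt (fun s => u x s) (u x t ^ p * lap (fun y => u y t) x) t)

/-- `u` is a global positive classical solution of the Cauchy problem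
`u_t = u^p Δu` on `ℝⁿ × (0,∞)`, `u(·,0) = u₀`. -/
def IsSol (n : ℕ) (p : ℝ) (u₀ : EuclideanSpace ℝ (Fin n) → ℝ)
    (u : EuclideanSpace ℝ (Fin n) → ℝ → ℝ) : Prop :=
  ContinuousOn (fun z : (EuclideanSpace ℝ (Fin n)) × ℝ => u z.1 z.2) {z | 0 ≤ z.2} ∧
  (∀ x, u x 0 = u₀ x) ∧
  (∀ x, ∀ t, 0 < t → 0 < u x t) ∧
  (∀ t, 0 < t → ContDiff ℝ 2 (fun y => u y t)) ∧
  (∀ x, ∀ t, 0 < t →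
    HasDerivAt (fun s => u x s) (u x t ^ p * lap (fun y => u y t) x) t)

/-- `u` is the minimal global positive classical solution of the Cauchy problem:
whenever `T ∈ (0,∞]` and `v` is a positive classical solution on `ℝⁿ × (0,T)`, then
`u ≤ v` there.  (Quantifying over all finite `T > 0` covers `T = ∞`, since the
restriction of a global solution solves the problem on every `(0,T)`.) -/
def IsMinimalSol (n : ℕ) (p : ℝ) (u₀ : EuclideanSpace ℝ (Fin n) → ℝ)
    (u : EuclideanSpace ℝ (Fin n) → ℝ → ℝ) : Prop :=
  IsSol n p u₀ u ∧
  ∀ T > (0:ℝ), ∀ v, IsSolOn n p u₀ v T → ∀ x, ∀ t, 0 ≤ t → t < T → u x t ≤ v x t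

theorem aux_second {φ : ℝ → ℝ} {b c d : ℝ} (hφ : ContinuousAt φ 0)
    (hd : ∀ s, DifferentiableAt ℝ φ s)
    (h2 : HasDerivAt (deriv φ) d 0)
    (hmin : ∀ᶠ s in nhds (0:ℝ), φ 0 ≤ φ s + c * (2 * s * b + s ^ 2)) : -2 * c ≤ d := by
  by_contra hcon
  push Not at hcon
  obtain ⟨e, he0, he⟩ : ∃ e, 0 < e ∧ d + 2 * c + 2 * e < 0 :=
    ⟨-(d + 2 * c) / 4, by linarith, by linarith⟩
  set h : ℝ → ℝ := fun s => φ s + (c * (2 * s * b + s ^ 2) + e * s ^ 2) with hh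
  have hq : ∀ s, HasDerivAt (fun s : ℝ => c * (2 * s * b + s ^ 2) + e * s ^ 2)
      (c * (2 * b + 2 * s) + e * (2 * s)) s := by
    intro s
    have h1 : HasDerivAt (fun s : ℝ => s ^ 2) (2 * s) s := by
      simpa using hasDerivAt_pow 2 s
    have h3 : HasDerivAt (fun s : ℝ => 2 * s * b) (2 * b) s := by
      simpa using ((hasDerivAt_id s).const_mul 2).mul_const b
    exact ((h3.add h1).const_mul c).add (h1.const_mul e)
  have hder : deriv h = fun s => deriv φ s + (c * (2 * b + 2 * s) + e * (2 * s)) := by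
    funext s
    exact ((hd s).hasDerivAt.add (hq s)).deriv
  have hlin : HasDerivAt (fun s : ℝ => c * (2 * b + 2 * s) + e * (2 * s)) (2 * c + 2 * e) 0 := by
    have h1 : HasDerivAt (fun s : ℝ => 2 * s) 2 0 := by
      simpa using (hasDerivAt_id (0:ℝ)).const_mul 2
    rw [show 2 * c + 2 * e = c * 2 + e * 2 by ring]
    exact ((h1.const_add (2 * b)).const_mul c).add (h1.const_mul e)
  have hdd : deriv (deriv h) 0 = d + (2 * c + 2 * e) := by
    rw [hder]; exact (h2.add hlin).deriv
  have hlm : IsLocalMin (fun s => φ s + c * (2 * s * b + s ^ 2)) 0 := by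
    filter_upwards [hmin] with s hs
    simpa using hs
  have hlm' : IsLocalMin h 0 := by
    filter_upwards [hmin] with s hs
    simp only [hh]
    nlinarith [mul_nonneg he0.le (sq_nonneg s)]
  have hmax : IsLocalMax h 0 := by
    apply isLocalMax_of_deriv_deriv_neg
    · rw [hdd]; linarith
    · exact hlm'.deriv_eq_zero
    · exact ((hd 0).hasDerivAt.add (hq 0)).continuousAt
  have hboth := hmin.and hmax
  obtain ⟨r, hr, hball⟩ := Metric.eventually_nhds_iff.1 hboth
  have := hball (y := r / 2) (by rw [Real.dist_eq]; rw [sub_zero, abs_of_pos (by linarith)]; linarith)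
  obtain ⟨h1, h2'⟩ := this
  simp only [hh] at h2'
  have : 0 < e * (r / 2) ^ 2 := by positivity
  nlinarith

theorem aux_lap {n : ℕ} {g : EuclideanSpace ℝ (Fin n) → ℝ} (hg : ContDiff ℝ 2 g)
    (x : EuclideanSpace ℝ (Fin n)) (c : ℝ)
    (hmin : ∀ᶠ y in nhds x, g x + c * ‖x‖ ^ 2 ≤ g y + c * ‖y‖ ^ 2) :
    -2 * c * n ≤ lap g x := by
  have key : ∀ i : Fin n, -2 * c ≤ fderiv ℝ (fun y => fderiv ℝ g y (EuclideanSpace.single i 1)) x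
      (EuclideanSpace.single i 1) := by
    intro i
    set e : EuclideanSpace ℝ (Fin n) := EuclideanSpace.single i 1 with he
    have hen : ‖e‖ = 1 := by simp [he]
    have hline : ∀ s : ℝ, HasDerivAt (fun s : ℝ => x + s • e) e s := by
      intro s
      simpa using ((hasDerivAt_id s).smul_const e).const_add x
    have hgd : Differentiable ℝ g := hg.differentiable (by norm_num)
    have hG : Differentiable ℝ (fun y => fderiv ℝ g y e) := by
      have : ContDiff ℝ 1 (fderiv ℝ g) := hg.fderiv_right (by norm_num)
      exact (this.differentiable (by norm_num)).clm_apply (differentiable_const e)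
    have hφ : ∀ s : ℝ, HasDerivAt (fun s : ℝ => g (x + s • e)) (fderiv ℝ g (x + s • e) e) s := by
      intro s
      exact (hgd (x + s • e)).hasFDerivAt.comp_hasDerivAt s (hline s)
    have hder : deriv (fun s : ℝ => g (x + s • e)) = fun s => fderiv ℝ g (x + s • e) e := by
      funext s; exact (hφ s).deriv
    refine aux_second (φ := fun s : ℝ => g (x + s • e)) (b := inner ℝ x e)
      (hφ 0).continuousAt (fun s => (hφ s).differentiableAt) ?_ ?_
    · rw [hder]
      have := (hG (x + (0:ℝ) • e)).hasFDerivAt.comp_hasDerivAt (0:ℝ) (hline 0)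
      simpa [Function.comp_def] using this
    · have hc : Tendsto (fun s : ℝ => x + s • e) (nhds 0) (nhds x) := by
        have := (hline 0).continuousAt.tendsto
        simpa using this
      filter_upwards [hc.eventually hmin] with s hs
      have hn : ‖x + s • e‖ ^ 2 = ‖x‖ ^ 2 + (2 * s * inner ℝ x e + s ^ 2) := by
        rw [norm_add_sq_real, norm_smul, inner_smul_right, hen]
        simp
        ring
      rw [hn] at hs
      simp only [zero_smul, add_zero]
      linarith
  unfold lap
  calc -2 * c * n = ∑ i : Fin n, (-2 * c) := by simp; ring
    _ ≤ _ := Finset.sum_le_sum (fun i _ => key i)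

theorem aux_comparison (n : ℕ) (hn : 1 ≤ n) (p : ℝ) (hp : 1 ≤ p)
    (u₀ : EuclideanSpace ℝ (Fin n) → ℝ) (u : EuclideanSpace ℝ (Fin n) → ℝ → ℝ)
    (hu : IsSol n p u₀ u) (M R : ℝ) (hM : 0 < M) (hR : 0 < R)
    (h0 : ∀ x, ‖x‖ ≤ R → M < u₀ x) (T : ℝ) (hT : 0 < T) :
    M * (1 + p * (4 * n * M ^ p / R ^ 2) * T) ^ (-(1:ℝ) / p) ≤ u 0 T := by
  obtain ⟨hcont, hinit, hpos, hC2, hpde⟩ := hu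
  have hn' : (1:ℝ) ≤ n := by exact_mod_cast hn
  have hMp : 0 < M ^ p := Real.rpow_pos_of_pos hM p
  set k : ℝ := 4 * n * M ^ p / R ^ 2 with hk
  have hkpos : 0 < k := by positivity
  set f : ℝ → ℝ := fun t => (1 + p * k * t) ^ (-(1:ℝ) / p) with hf
  have hbase : ∀ t, 0 ≤ t → 0 < 1 + p * k * t := by intro t ht; positivity
  have hfpos : ∀ t, 0 ≤ t → 0 < f t := fun t ht => Real.rpow_pos_of_pos (hbase t ht) _
  have hfd : ∀ t, 0 ≤ t → HasDerivAt f (-k * f t ^ p * f t) t := by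
    intro t ht
    have h1 : HasDerivAt (fun t : ℝ => 1 + p * k * t) (p * k) t := by
      simpa using ((hasDerivAt_id t).const_mul (p * k)).const_add 1
    have h2 := h1.rpow_const (p := -(1:ℝ) / p) (Or.inl (hbase t ht).ne')
    convert h2 using 1
    have h3 : f t ^ p = (1 + p * k * t) ^ (-1 : ℝ) := by
      simp only [hf]
      rw [← Real.rpow_mul (hbase t ht).le]
      congr 1
      field_simp
    rw [h3]
    simp only [hf]
    rw [sub_eq_add_neg, Real.rpow_add (hbase t ht)]
    field_simp
  set v : EuclideanSpace ℝ (Fin n) → ℝ → ℝ := fun x t => f t * (M * (1 - ‖x‖ ^ 2 / R ^ 2)) with hv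
  by_contra hcon
  push Not at hcon
  set K : Set (EuclideanSpace ℝ (Fin n) × ℝ) := closedBall 0 R ×ˢ Icc 0 T with hK
  have hKc : IsCompact K := (isCompact_closedBall _ _).prod isCompact_Icc
  have hucK : ContinuousOn (fun z : EuclideanSpace ℝ (Fin n) × ℝ => u z.1 z.2) K :=
    hcont.mono (fun z hz => hz.2.1)
  have hfc : ContinuousOn f (Icc 0 T) := fun t ht => (hfd t ht.1).continuousAt.continuousWithinAt
  have hvcK : ContinuousOn (fun z : EuclideanSpace ℝ (Fin n) × ℝ => v z.1 z.2) K := by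
    apply ContinuousOn.mul
    · exact hfc.comp continuousOn_snd (fun z hz => hz.2)
    · fun_prop
  set S : Set (EuclideanSpace ℝ (Fin n) × ℝ) :=
    K ∩ (fun z : EuclideanSpace ℝ (Fin n) × ℝ => u z.1 z.2 - v z.1 z.2) ⁻¹' Iic 0 with hS
  have hSclosed : IsClosed S :=
    (hucK.sub hvcK).preimage_isClosed_of_isClosed hKc.isClosed isClosed_Iic
  have hSc : IsCompact S := hKc.of_isClosed_subset hSclosed inter_subset_left
  have hSne : S.Nonempty := by
    refine ⟨(0, T), ⟨⟨by simp [hR.le], hT.le, le_rfl⟩, ?_⟩⟩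
    simp only [mem_preimage, mem_Iic, hv, norm_zero]
    have : f T * (M * (1 - 0 ^ 2 / R ^ 2)) = M * f T := by ring
    rw [this]
    linarith
  obtain ⟨⟨x, t⟩, hxtS, hmin⟩ := hSc.exists_isMinOn hSne continuous_snd.continuousOn
  have hx : ‖x‖ ≤ R := by simpa using hxtS.1.1
  have ht0 : 0 ≤ t := hxtS.1.2.1
  have htT : t ≤ T := hxtS.1.2.2
  have hle : u x t ≤ v x t := by
    have : u x t - v x t ≤ 0 := hxtS.2
    linarith
  have hbefore : ∀ y s, ‖y‖ ≤ R → 0 ≤ s → s < t → v y s < u y s := by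
    intro y s hy hs hst
    by_contra hc
    push Not at hc
    have : (y, s) ∈ S := ⟨⟨by simpa using hy, hs, by linarith⟩, by
      simp only [mem_preimage, mem_Iic]; linarith⟩
    have h3 : t ≤ s := hmin this
    linarith
  have htpos : 0 < t := by
    rcases ht0.lt_or_eq with h | h
    · exact h
    · exfalso
      subst h
      have h1 := h0 x hx
      rw [hinit] at hle
      have : v x 0 ≤ M := by
        simp only [hv, hf]
        have : 0 ≤ ‖x‖ ^ 2 / R ^ 2 := by positivity
        simp
        nlinarith
      linarith
  have hxR : ‖x‖ < R := by
    rcases hx.lt_or_eq with h | h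
    · exact h
    · exfalso
      have h1 := hpos x t htpos
      have : v x t = 0 := by
        simp only [hv, h]
        rw [div_self (by positivity)]; simp
      linarith
  have hvd : ∀ y, HasDerivAt (fun s => v y s) ((-k * f t ^ p * f t) * (M * (1 - ‖y‖ ^ 2 / R ^ 2))) t :=
    fun y => (hfd t ht0).mul_const _
  have hleft : ∀ᶠ s in nhdsWithin t (Iio t), 0 ≤ s ∧ s < t := by
    have h1 : ∀ᶠ s in nhdsWithin t (Iio t), 0 < s :=
      nhdsWithin_le_nhds (eventually_gt_nhds htpos)
    filter_upwards [h1, self_mem_nhdsWithin] with s hs hs'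
    exact ⟨hs.le, hs'⟩
  have hat : ∀ y, ‖y‖ ≤ R → v y t ≤ u y t := by
    intro y hy
    have h1 : Tendsto (fun s => v y s) (nhdsWithin t (Iio t)) (nhds (v y t)) :=
      (hvd y).continuousAt.tendsto.mono_left nhdsWithin_le_nhds
    have h2 : Tendsto (fun s => u y s) (nhdsWithin t (Iio t)) (nhds (u y t)) :=
      (hpde y t htpos).continuousAt.tendsto.mono_left nhdsWithin_le_nhds
    refine le_of_tendsto_of_tendsto h1 h2 ?_
    filter_upwards [hleft] with s hs
    exact (hbefore y s hy hs.1 hs.2).le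
  have heq : u x t = v x t := le_antisymm hle (hat x hx)
  have hlap := aux_lap (hC2 t htpos) x (f t * M / R ^ 2) (by
    have hb : ∀ᶠ y in nhds x, ‖y‖ < R := continuous_norm.continuousAt.eventually_lt_const hxR
    filter_upwards [hb] with y hy
    have h1 := hat y hy.le
    rw [heq]
    have e : ∀ z, v z t = f t * M - f t * M / R ^ 2 * ‖z‖ ^ 2 := by
      intro z; simp only [hv]; ring
    rw [e] at h1 ⊢
    linarith)
  have hgd : HasDerivAt (fun s => u x s - v x s) _ t := (hpde x t htpos).sub (hvd x)
  have hderle : u x t ^ p * lap (fun y => u y t) x -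
      (-k * f t ^ p * f t) * (M * (1 - ‖x‖ ^ 2 / R ^ 2)) ≤ 0 := by
    have hsl := hgd.hasDerivWithinAt (s := Iio t)
    rw [hasDerivWithinAt_iff_tendsto_slope' (by simp)] at hsl
    refine le_of_tendsto hsl ?_
    filter_upwards [hleft] with s hs
    rw [slope_def_field]
    have h1 := hbefore x s hx hs.1 hs.2
    apply div_nonpos_of_nonneg_of_nonpos
    · rw [heq]; linarith
    · linarith [hs.2]
  set q := 1 - ‖x‖ ^ 2 / R ^ 2 with hq
  have hqpos : 0 < q := by
    have : ‖x‖ ^ 2 / R ^ 2 < 1 := by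
      rw [div_lt_one (by positivity)]
      have := norm_nonneg x
      nlinarith
    linarith
  have hq1 : q ≤ 1 := by
    have : 0 ≤ ‖x‖ ^ 2 / R ^ 2 := by positivity
    linarith
  have hux : u x t = f t * (M * q) := heq
  rw [hux, Real.mul_rpow (hfpos t ht0).le (by positivity), Real.mul_rpow hM.le hqpos.le] at hderle
  have hqp : q ^ p ≤ q := by
    have := Real.rpow_le_rpow_of_exponent_ge hqpos hq1 hp
    simpa using this
  have hF := hfpos t ht0
  have hFp : 0 < f t ^ p := Real.rpow_pos_of_pos hF p
  have hqpp : 0 < q ^ p := Real.rpow_pos_of_pos hqpos p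
  have h5 := mul_le_mul_of_nonneg_left hlap (show 0 ≤ f t ^ p * (M ^ p * q ^ p) by positivity)
  -- combine
  have h6 : f t ^ p * (M ^ p * q ^ p) * (-2 * (f t * M / R ^ 2) * n)
      = -(f t ^ p * f t * M * (2 * n * M ^ p / R ^ 2)) * q ^ p := by ring
  have h7 : -k * f t ^ p * f t * (M * q) = - (f t ^ p * f t * M * (2 * n * M ^ p / R ^ 2)) * (2 * q) := by
    rw [hk]; ring
  rw [h6] at h5
  rw [h7] at hderle
  have hA : 0 < f t ^ p * f t * M * (2 * n * M ^ p / R ^ 2) := by positivity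
  nlinarith

theorem aux_eventually (A B γ : ℝ) (hA : 0 < A) (hB : 0 < B) :
    ∀ᶠ t : ℝ in atTop, (Real.log t / B) ^ γ ≤ A * t ^ (1/2 : ℝ) := by
  have h := (isLittleO_log_rpow_rpow_atTop γ (show (0:ℝ) < 1/2 by norm_num)).bound
    (show 0 < A * B ^ γ by positivity)
  filter_upwards [h, eventually_gt_atTop 1] with t ht ht1
  have hl : 0 < Real.log t := Real.log_pos ht1
  have hBg : 0 < B ^ γ := by positivity
  rw [Real.norm_of_nonneg (by positivity), Real.norm_of_nonneg (by positivity)] at ht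
  rw [Real.div_rpow hl.le hB.le, div_le_iff₀ hBg]
  linarith

/-- Corollary 1.7 of Fila–Winkler.
If `p ≥ 1` and `u₀ ∈ C⁰(ℝⁿ)` satisfies `u₀(x) ≥ c₀ e^{-α|x|^β}`, then there are
`t₀ > 1` and `C > 0` such that every positive classical solution satisfies
`‖u(·,t)‖_{L^∞(ℝⁿ)} ≥ C t^{-1/p} (ln t)^{2/(pβ)}` for all `t ≥ t₀`, the `L^∞`
norm being the essential supremum `eLpNorm · ∞`. -/
theorem stmt_13 (n : ℕ) (hn : 1 ≤ n)
    (p c₀ α β : ℝ) (hp : 1 ≤ p) (hc₀ : 0 < c₀) (hα : 0 < α) (hβ : 0 < β)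
    (u₀ : EuclideanSpace ℝ (Fin n) → ℝ)
    (hu₀cont : Continuous u₀)
    (hu₀dec : ∀ x, c₀ * Real.exp (-α * ‖x‖ ^ β) ≤ u₀ x) :
    ∃ t₀ > (1:ℝ), ∃ C > (0:ℝ), ∀ u : EuclideanSpace ℝ (Fin n) → ℝ → ℝ,
      IsSol n p u₀ u → ∀ t ≥ t₀,
      ENNReal.ofReal (C * t ^ (-(1:ℝ)/p) * Real.log t ^ (2/(p*β))) ≤
        eLpNorm (fun x => u x t) ⊤ volume := by
  obtain ⟨t₁, ht₁⟩ := eventually_atTop.1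
    (aux_eventually (4 * n * p * (c₀ / 2) ^ p) (2 * p * α) (2 / β)
      (by have : (1:ℝ) ≤ n := by exact_mod_cast hn
          positivity) (by positivity))
  have hn' : (1:ℝ) ≤ n := by exact_mod_cast hn
  have hp0 : 0 < p := by linarith
  refine ⟨max t₁ 2, lt_of_lt_of_le (by norm_num) (le_max_right _ _),
    (8 * n * p) ^ (-(1:ℝ) / p) * (2 * p * α) ^ (-(2 / (p * β))), by positivity, ?_⟩
  intro u hu t ht
  have htt : t₁ ≤ t := le_trans (le_max_left _ _) ht
  have ht2 : 2 ≤ t := le_trans (le_max_right _ _) ht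
  have ht0 : 0 < t := by linarith
  have hl : 0 < Real.log t := Real.log_pos (by linarith)
  set L : ℝ := Real.log t / (2 * p * α) with hL
  have hLpos : 0 < L := by positivity
  set R : ℝ := L ^ (1 / β) with hR
  have hRpos : 0 < R := by positivity
  have hRβ : R ^ β = L := by
    rw [hR, ← Real.rpow_mul hLpos.le, one_div_mul_cancel hβ.ne', Real.rpow_one]
  have hR2 : R ^ 2 = L ^ (2 / β) := by
    rw [hR, ← Real.rpow_natCast, ← Real.rpow_mul hLpos.le]
    congr 1
    push_cast
    ring
  set M : ℝ := c₀ / 2 * Real.exp (-α * L) with hM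
  have hMpos : 0 < M := by positivity
  have hMp : M ^ p = (c₀ / 2) ^ p * t ^ (-(1/2) : ℝ) := by
    rw [hM, Real.mul_rpow (by positivity) (Real.exp_pos _).le, ← Real.exp_mul,
      Real.rpow_def_of_pos ht0]
    congr 2
    rw [hL]
    field_simp
  have hcmp := aux_comparison n hn p hp u₀ u hu M R hMpos hRpos (by
    intro x hx
    have h1 : ‖x‖ ^ β ≤ L := by
      rw [← hRβ]
      exact Real.rpow_le_rpow (norm_nonneg x) hx hβ.le
    have h2 : Real.exp (-α * L) ≤ Real.exp (-α * ‖x‖ ^ β) :=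
      Real.exp_le_exp.2 (by nlinarith)
    have h3 := hu₀dec x
    have h4 := Real.exp_pos (-α * L)
    have h5 := mul_le_mul_of_nonneg_left h2 hc₀.le
    have h6 : 0 < c₀ * Real.exp (-α * L) := by positivity
    rw [hM]
    linarith) t ht0
  have hMpp : 0 < M ^ p := Real.rpow_pos_of_pos hMpos p
  have hbig : 1 ≤ p * (4 * n * M ^ p / R ^ 2) * t := by
    have h1 := ht₁ t htt
    have h2 : p * (4 * n * M ^ p / R ^ 2) * t
        = (4 * n * p * (c₀ / 2) ^ p * t ^ (1/2 : ℝ)) / R ^ 2 := by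
      have h3 : t ^ (-(1/2) : ℝ) * t = t ^ (1/2 : ℝ) := by
        rw [← Real.rpow_add_one ht0.ne']; norm_num
      rw [hMp, ← h3]; ring
    rw [h2, one_le_div (by positivity), hR2]
    exact h1
  have hlow : (8 * n * p) ^ (-(1:ℝ) / p) * (2 * p * α) ^ (-(2 / (p * β))) * t ^ (-(1:ℝ) / p)
      * Real.log t ^ (2 / (p * β)) ≤ u 0 t := by
    refine le_trans ?_ hcmp
    have h1 : (2 * (p * (4 * n * M ^ p / R ^ 2) * t)) ^ (-(1:ℝ) / p)
        ≤ (1 + p * (4 * n * M ^ p / R ^ 2) * t) ^ (-(1:ℝ) / p) := by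
      apply Real.rpow_le_rpow_of_nonpos (by linarith) (by linarith)
      rw [neg_div]
      have : 0 < 1 / p := by positivity
      linarith
    refine le_trans (le_of_eq ?_) (mul_le_mul_of_nonneg_left h1 hMpos.le)
    have h2 : 2 * (p * (4 * n * M ^ p / R ^ 2) * t) = (8 * n * p) * t * M ^ p * L ^ (-(2 / β)) := by
      rw [hR2, Real.rpow_neg hLpos.le]; ring
    have hLp : 0 < L ^ (-(2 / β)) := Real.rpow_pos_of_pos hLpos _
    rw [h2, Real.mul_rpow (x := 8 * n * p * t * M ^ p) (by positivity) hLp.le,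
      Real.mul_rpow (x := 8 * n * p * t) (by positivity) hMpp.le,
      Real.mul_rpow (x := 8 * n * p) (by positivity) ht0.le, ← Real.rpow_mul hMpos.le, ← Real.rpow_mul hLpos.le]
    have h3 : p * (-(1:ℝ) / p) = -1 := by field_simp
    have h4 : -(2 / β) * (-(1:ℝ) / p) = 2 / (p * β) := by field_simp
    rw [h3, h4, hL, Real.div_rpow hl.le (by positivity), Real.rpow_neg_one,
      Real.rpow_neg (by positivity)]
    field_simp
  have hucont : Continuous (fun x => u x t) := (hu.2.2.2.1 t ht0).continuous
  refine le_trans (ENNReal.ofReal_le_ofReal hlow) ?_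
  rw [eLpNorm_exponent_top]
  have hdense := Measure.dense_of_ae (ae_le_eLpNormEssSup (μ := volume) (f := fun x => u x t))
  have hclosed : IsClosed {x | ‖u x t‖ₑ ≤ eLpNormEssSup (fun x => u x t) volume} :=
    isClosed_le hucont.enorm continuous_const
  have huniv := hclosed.closure_eq ▸ hdense.closure_eq
  have h0mem : (0 : EuclideanSpace ℝ (Fin n)) ∈
      {x | ‖u x t‖ₑ ≤ eLpNormEssSup (fun x => u x t) volume} := by
    rw [huniv]; trivial
  rw [← Real.enorm_of_nonneg (hu.2.2.1 0 t ht0).le]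
  exact h0mem
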